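/- (Pohozaev boundary integral of the half-plane Green function.) Let z = (z₁, 0) with z₁ > 0 and define 𝔾(x) := (1/(2π)) ln(|x − z̄|/|x − z|) for x ∈ Π \ {z}, where z̄ = (−z₁, 0). Then for every δ ∈ (0, z₁): −∫_{∂B_δ(z)} (∂𝔾/∂ν)(∂𝔾/∂x₁) dσ + (1/2) ∫_{∂B_δ(z)} |∇𝔾|² ν₁ dσ = 1/(4π z₁), where ν = (ν₁, ν₂) is the outward unit normal to the circle ∂B_δ(z), ∂𝔾/∂ν = ∇𝔾·ν, and dσ is the arc-length (1-dimensional Hausdorff) measure on ∂B_δ(z). -/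

import Mathlib

open MeasureTheory Real Filter
open scoped RealInnerProductSpace

noncomputable section

/-- The plane `ℝ²` with the Euclidean norm. -/
abbrev Plane : Type := EuclideanSpace ℝ (Fin 2)

/-- The point `(a, b)` of the plane. -/
def mk2 (a b : ℝ) : Plane := (WithLp.equiv 2 (Fin 2 → ℝ)).symm ![a, b]

/-- The open right half plane `Π = {x : x₁ > 0}`. -/
def halfPlane : Set Plane := {x : Plane | 0 < x 0}

/-- The reflection `x̄ = (−x₁, x₂)` of a point `x = (x₁, x₂)`. -/
def reflPt (x : Plane) : Plane := mk2 (-(x 0)) (x 1)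

/-- The Green function `G_*` on the half plane of the operator `−(1/x₁)div((1/x₁)∇)`. -/
def Gstar (x x' : Plane) : ℝ :=
  x 0 * (x' 0) ^ 2 / (4 * π) *
    ∫ θ in (-π)..π, Real.cos θ /
      Real.sqrt ((x 1 - x' 1) ^ 2 + (x 0) ^ 2 + (x' 0) ^ 2 - 2 * x 0 * x' 0 * Real.cos θ)

/-- The Green function of `−Δ` on the half plane. -/
def Gfun (x x' : Plane) : ℝ :=
  (1 / (4 * π)) * Real.log
    (((x 0 + x' 0) ^ 2 + (x 1 - x' 1) ^ 2) / ((x 0 - x' 0) ^ 2 + (x 1 - x' 1) ^ 2))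

/-- The regular part `H_c(x,x') = G_*(x,x') − c² G(x,x')`. -/
def Hker (c : ℝ) (x x' : Plane) : ℝ := Gstar x x' - c ^ 2 * Gfun x x'

/-- The regular part `H_c`, extended continuously to the diagonal. -/
def HkerExt (c : ℝ) (x x' : Plane) : ℝ := by
  classical
  exact if x = x' then limUnder (nhdsWithin x' {x'}ᶜ) (fun y => Hker c y x')
    else Hker c x x'

/-- The cross-section `A = {x ∈ Π : ψ(x) − (W/2) x₁² ln(1/ε) > μ}`. -/
def crossSection (ψ : Plane → ℝ) (ε W μ : ℝ) : Set Plane :=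
  {x : Plane | x ∈ halfPlane ∧ μ < ψ x - W / 2 * (x 0) ^ 2 * Real.log (1 / ε)}

/-- `ψ` is a stream function of a steady vortex ring with parameters `(ε, W, μ)`. -/
structure IsVortexRingStream (ψ : Plane → ℝ) (ε W μ : ℝ) : Prop where
  continuousOn : ContinuousOn ψ halfPlane
  bounded : Bornology.IsBounded (crossSection ψ ε W μ)
  closure_subset : closure (crossSection ψ ε W μ) ⊆ halfPlane
  repr : ∀ x ∈ halfPlane, ψ x = (∫ x' in crossSection ψ ε W μ, Gstar x x') / ε ^ 2

/-- The circulation `ε⁻² ∫_A x₁ dx` of a vortex ring. -/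
def circulation (ψ : Plane → ℝ) (ε W μ : ℝ) : ℝ :=
  (∫ x in crossSection ψ ε W μ, x 0) / ε ^ 2

/-- `ψ` is centralized: it is even in the second variable. -/
def Centralized (ψ : Plane → ℝ) : Prop :=
  ∀ a b : ℝ, ψ (mk2 a (-b)) = ψ (mk2 a b)

theorem volume_le_hausdorffMeasure_image {X : Type*} [MetricSpace X] [MeasurableSpace X]
    [BorelSpace X] (γ : ℝ → X) (S : Set ℝ) (K : NNReal)
    (h : ∀ x ∈ S, ∀ y ∈ S, dist x y ≤ K * dist (γ x) (γ y)) :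
    volume S ≤ K * μH[1] (γ '' S) := by
  have hA : AntilipschitzWith K (S.domRestrict γ) :=
    AntilipschitzWith.of_le_mul_dist fun x y => h x x.2 y y.2
  have h1 := hA.le_hausdorffMeasure_image (d := 1) zero_le_one Set.univ
  have h2 := (isometry_subtype_coe (s := S)).hausdorffMeasure_image (d := 1)
    (Or.inl zero_le_one) Set.univ
  rw [Set.image_univ, Set.range_domRestrict, ← h2, Set.image_univ, Subtype.range_coe,
    hausdorffMeasure_real, ENNReal.rpow_one] at h1
  exact h1

/-- The parametrization of the circle of radius `δ` about `z` by the angle. -/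
def circlePt (z : Plane) (δ θ : ℝ) : Plane := z + mk2 (δ * cos θ) (δ * sin θ)

@[simp] theorem mk2_zero (a b : ℝ) : mk2 a b 0 = a := rfl

@[simp] theorem mk2_one (a b : ℝ) : mk2 a b 1 = b := rfl

@[simp] theorem circlePt_zero (z : Plane) (δ θ : ℝ) : circlePt z δ θ 0 = z 0 + δ * cos θ := rfl

@[simp] theorem circlePt_one (z : Plane) (δ θ : ℝ) : circlePt z δ θ 1 = z 1 + δ * sin θ := rfl

theorem norm_sq_plane (x : Plane) : ‖x‖ ^ 2 = x 0 ^ 2 + x 1 ^ 2 := by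
  simp [EuclideanSpace.norm_sq_eq, Fin.sum_univ_two]

theorem continuous_circlePt (z : Plane) (δ : ℝ) : Continuous (circlePt z δ) := by
  unfold circlePt mk2
  refine continuous_const.add ((PiLp.continuous_toLp 2 _).comp (continuous_pi fun i => ?_))
  fin_cases i <;> simp <;> fun_prop

theorem dist_circlePt (z : Plane) {δ : ℝ} (hδ : 0 ≤ δ) (θ φ : ℝ) :
    dist (circlePt z δ θ) (circlePt z δ φ) = 2 * δ * |sin ((θ - φ) / 2)| := by
  rw [dist_eq_norm, ← abs_of_nonneg (norm_nonneg _), ← abs_of_nonneg (by positivity : 0 ≤ 2 * δ),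
    ← abs_mul, ← sq_eq_sq_iff_abs_eq_abs, norm_sq_plane]
  simp only [PiLp.sub_apply, circlePt_zero, circlePt_one]
  have h1 := cos_sub_cos θ φ
  have h2 := sin_sub_sin θ φ
  have h3 := sin_sq_add_cos_sq ((θ + φ) / 2)
  linear_combination δ ^ 2 * (cos θ - cos φ + (-2 * sin ((θ + φ) / 2) * sin ((θ - φ) / 2))) * h1
    + δ ^ 2 * (sin θ - sin φ + (2 * sin ((θ - φ) / 2) * cos ((θ + φ) / 2))) * h2
    + 4 * δ ^ 2 * sin ((θ - φ) / 2) ^ 2 * h3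

theorem lipschitzWith_circlePt (z : Plane) (δ : NNReal) : LipschitzWith δ (circlePt z δ) := by
  refine LipschitzWith.of_dist_le_mul fun θ φ => ?_
  rw [dist_circlePt z δ.coe_nonneg, Real.dist_eq]
  have h : |sin ((θ - φ) / 2)| ≤ |(θ - φ) / 2| := abs_sin_le_abs
  rw [abs_div, abs_two] at h
  have := mul_le_mul_of_nonneg_left h (by positivity : (0 : ℝ) ≤ 2 * δ)
  linarith

theorem mul_dist_le_dist_circlePt (z : Plane) {δ h : ℝ} (hδ : 0 ≤ δ) {θ φ : ℝ}
    (hθφ : |θ - φ| ≤ h) :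
    (1 - h ^ 2) * δ * dist θ φ ≤ dist (circlePt z δ θ) (circlePt z δ φ) := by
  rw [dist_circlePt z hδ, Real.dist_eq]
  have h0 := abs_nonneg (θ - φ)
  have h1 : |θ - φ| / 2 - (|θ - φ| / 2) ^ 3 / 6 ≤ |sin ((θ - φ) / 2)| := by
    refine (sin_ge_sub_cube (by positivity)).trans ?_
    rcases abs_cases (θ - φ) with ⟨h, -⟩ | ⟨h, -⟩ <;> rw [h]
    · exact le_abs_self _
    · rw [neg_div, sin_neg]
      exact neg_le_abs _
  have h2 : |θ - φ| ^ 2 ≤ h ^ 2 := pow_le_pow_left₀ h0 hθφ 2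
  have h3 : (1 - h ^ 2) * |θ - φ| ≤ 2 * |sin ((θ - φ) / 2)| := by
    nlinarith [mul_le_mul_of_nonneg_right h2 h0, pow_nonneg h0 3]
  nlinarith [mul_le_mul_of_nonneg_left h3 hδ]

theorem injOn_circlePt (z : Plane) {δ : ℝ} (hδ : 0 < δ) :
    Set.InjOn (circlePt z δ) (Set.Ioc (-π) π) := by
  intro θ hθ φ hφ h
  have hd := dist_circlePt z hδ.le θ φ
  rw [h, dist_self] at hd
  have hs : sin ((θ - φ) / 2) = 0 := by
    have : |sin ((θ - φ) / 2)| = 0 := by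
      rcases mul_eq_zero.1 hd.symm with h | h
      · linarith
      · exact h
    exact abs_eq_zero.1 this
  have := (sin_eq_zero_iff_of_lt_of_lt (by linarith [hθ.1, hφ.2]) (by linarith [hθ.2, hφ.1])).1 hs
  linarith

theorem image_circlePt (z : Plane) {δ : ℝ} (hδ : 0 < δ) :
    circlePt z δ '' Set.Ioc (-π) π = Metric.sphere z δ := by
  ext x
  constructor
  · rintro ⟨θ, -, rfl⟩
    rw [mem_sphere_iff_norm, ← sq_eq_sq₀ (norm_nonneg _) hδ.le, norm_sq_plane]
    simp only [PiLp.sub_apply, circlePt_zero, circlePt_one]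
    linear_combination δ ^ 2 * sin_sq_add_cos_sq θ
  · intro hx
    rw [mem_sphere_iff_norm] at hx
    set w : ℂ := ⟨x 0 - z 0, x 1 - z 1⟩ with hw
    have hn : ‖w‖ = δ := by
      rw [← hx, ← abs_of_nonneg (norm_nonneg w), ← abs_of_nonneg (norm_nonneg (x - z)),
        ← sq_eq_sq_iff_abs_eq_abs, norm_sq_plane, Complex.sq_norm, Complex.normSq_apply]
      simp only [PiLp.sub_apply, hw]
      ring
    refine ⟨w.arg, ⟨Complex.neg_pi_lt_arg w, Complex.arg_le_pi w⟩, ?_⟩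
    have h0 := Complex.norm_mul_cos_arg w
    have h1 := Complex.norm_mul_sin_arg w
    rw [hn] at h0 h1
    ext i
    fin_cases i
    · change z 0 + δ * cos w.arg = x 0
      rw [h0]
      exact add_sub_cancel _ _
    · change z 1 + δ * sin w.arg = x 1
      rw [h1]
      exact add_sub_cancel _ _

theorem hausdorffMeasure_image_circlePt (z : Plane) {δ : ℝ} (hδ : 0 < δ) {S : Set ℝ}
    (hS : MeasurableSet S) (hSI : S ⊆ Set.Ioc (-π) π) :
    μH[1] (circlePt z δ '' S) = ENNReal.ofReal δ * volume S := by
  have hfin : volume S ≠ ⊤ := ((measure_mono hSI).trans_lt measure_Ioc_lt_top).ne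
  apply le_antisymm
  · have := (lipschitzWith_circlePt z ⟨δ, hδ.le⟩).hausdorffMeasure_image_le
      (d := 1) zero_le_one S
    rw [ENNReal.rpow_one, hausdorffMeasure_real] at this
    rwa [ENNReal.ofReal, Real.toNNReal_of_nonneg hδ.le]
  · have key : ∀ h ∈ Set.Ioo (0 : ℝ) 1,
        ENNReal.ofReal ((1 - h ^ 2) * δ) * volume S ≤ μH[1] (circlePt z δ '' S) := by
      intro h hh
      have hK : 0 < (1 - h ^ 2) * δ := mul_pos (by nlinarith [hh.1, hh.2]) hδ
      have hKe : ENNReal.ofReal ((1 - h ^ 2) * δ) ≠ 0 := by simpa using hK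
      let T : ℤ → Set ℝ := fun n => S ∩ Set.Ioc (n • h) ((n + 1) • h)
      have hTm : ∀ n, MeasurableSet (T n) := fun n => hS.inter measurableSet_Ioc
      have hTS : ∀ n, T n ⊆ S := fun n => Set.inter_subset_left
      have hTd : Pairwise (Function.onFun Disjoint T) := fun m n hmn =>
        ((Set.pairwise_disjoint_Ioc_zsmul h) hmn).mono Set.inter_subset_right
          Set.inter_subset_right
      have hTU : ⋃ n, T n = S := by
        rw [← Set.inter_iUnion, iUnion_Ioc_zsmul hh.1, Set.inter_univ]
      have hinj := (injOn_circlePt z hδ).mono hSI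
      have hle : ∀ n, ENNReal.ofReal ((1 - h ^ 2) * δ) * volume (T n)
          ≤ μH[1] (circlePt z δ '' T n) := by
        intro n
        have := volume_le_hausdorffMeasure_image (circlePt z δ) (T n)
          (Real.toNNReal ((1 - h ^ 2) * δ)⁻¹) ?_
        · calc _ ≤ ENNReal.ofReal ((1 - h ^ 2) * δ) * _ := mul_le_mul_right this _
            _ = _ := by
              rw [← mul_assoc, ← ENNReal.ofReal, ENNReal.ofReal_inv_of_pos hK,
                ENNReal.mul_inv_cancel hKe ENNReal.ofReal_ne_top, one_mul]
        · intro x hx y hy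
          rw [Real.coe_toNNReal _ (inv_pos.2 hK).le, ← div_eq_inv_mul, le_div_iff₀ hK, mul_comm]
          refine mul_dist_le_dist_circlePt z hδ.le ?_
          have h1 := hx.2
          have h2 := hy.2
          simp only [zsmul_eq_mul, Set.mem_Ioc, Int.cast_add, Int.cast_one, add_mul, one_mul]
            at h1 h2
          rw [abs_le]
          constructor <;> linarith [h1.1, h1.2, h2.1, h2.2]
      calc ENNReal.ofReal ((1 - h ^ 2) * δ) * volume S
          = ∑' n, ENNReal.ofReal ((1 - h ^ 2) * δ) * volume (T n) := by
            rw [ENNReal.tsum_mul_left, ← measure_iUnion hTd hTm, hTU]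
        _ ≤ ∑' n, μH[1] (circlePt z δ '' T n) := ENNReal.tsum_le_tsum hle
        _ = μH[1] (circlePt z δ '' S) := by
            rw [← measure_iUnion, ← Set.image_iUnion, hTU]
            · exact fun m n hmn => Set.disjoint_image_image fun x hx y hy hxy =>
                Set.disjoint_left.1 (hTd hmn) hx (hinj (hTS _ hx) (hTS _ hy) hxy ▸ hy)
            · exact fun n => (hTm n).image_of_continuousOn_injOn
                (continuous_circlePt z δ).continuousOn (hinj.mono (hTS n))
    have hlim : Tendsto (fun h : ℝ => ENNReal.ofReal ((1 - h ^ 2) * δ) * volume S)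
        (nhdsWithin 0 (Set.Ioi 0)) (nhds (ENNReal.ofReal δ * volume S)) := by
      refine ENNReal.Tendsto.mul_const (ENNReal.tendsto_ofReal ?_) (Or.inr hfin)
      have : Continuous fun h : ℝ => (1 - h ^ 2) * δ := by fun_prop
      simpa using (this.tendsto 0).mono_left nhdsWithin_le_nhds
    exact le_of_tendsto hlim (by
      filter_upwards [Ioo_mem_nhdsGT zero_lt_one] with h hh using key h hh)

theorem hausdorffMeasure_restrict_sphere (z : Plane) {δ : ℝ} (hδ : 0 < δ) :
    (μH[1] : Measure Plane).restrict (Metric.sphere z δ) =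
      ENNReal.ofReal δ • (volume.restrict (Set.Ioc (-π) π)).map (circlePt z δ) := by
  have hm : Measurable (circlePt z δ) := (continuous_circlePt z δ).measurable
  ext B hB
  rw [Measure.restrict_apply hB, Measure.smul_apply, Measure.map_apply hm hB,
    Measure.restrict_apply (hm hB), smul_eq_mul,
    ← hausdorffMeasure_image_circlePt z hδ ((hm hB).inter measurableSet_Ioc)
      Set.inter_subset_right, Set.inter_comm, ← image_circlePt z hδ, Set.inter_comm,
    Set.image_preimage_inter]

theorem integral_sphere_eq_intervalIntegral (z : Plane) {δ : ℝ} (hδ : 0 < δ) {f : Plane → ℝ}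
    (hf : Measurable f) :
    ∫ x in Metric.sphere z δ, f x ∂μH[1] = δ * ∫ θ in (-π)..π, f (circlePt z δ θ) := by
  rw [hausdorffMeasure_restrict_sphere z hδ, integral_smul_measure,
    integral_map (continuous_circlePt z δ).aemeasurable hf.aestronglyMeasurable,
    ENNReal.toReal_ofReal hδ.le, intervalIntegral.integral_of_le (by linarith [pi_pos]),
    smul_eq_mul]

theorem hasGradientAt_log_norm_div {p q x : Plane} (hp : x ≠ p) (hq : x ≠ q) :
    HasGradientAt (fun x => (1 / (2 * π)) * Real.log (‖x - p‖ / ‖x - q‖))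
      ((1 / (2 * π)) • ((‖x - p‖ ^ 2)⁻¹ • (x - p) - (‖x - q‖ ^ 2)⁻¹ • (x - q))) x := by
  have hlog : ∀ {r : Plane}, x ≠ r → HasFDerivAt (fun y : Plane => Real.log ‖y - r‖)
      ((‖x - r‖ ^ 2)⁻¹ • innerSL ℝ (x - r)) x := by
    intro r hr
    have h := (((hasFDerivAt_id x).sub_const r).norm_sq.log
      (pow_ne_zero 2 (norm_ne_zero_iff.2 (sub_ne_zero.2 hr)))).const_mul (1 / 2)
    refine (h.congr_fderiv ?_).congr_of_eventuallyEq (Eventually.of_forall fun y => ?_)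
    · ext v
      simp
      ring
    · simp [Real.log_pow]
  have hG := ((hlog hp).sub (hlog hq)).const_mul (1 / (2 * π))
  rw [hasGradientAt_iff_hasFDerivAt]
  refine HasFDerivAt.congr_of_eventuallyEq (f := fun y : Plane =>
    1 / (2 * π) * (Real.log ‖y - p‖ - Real.log ‖y - q‖)) ?_ ?_
  · refine hG.congr_fderiv ?_
    ext v
    simp
  · filter_upwards [isOpen_ne.mem_nhds hp, isOpen_ne.mem_nhds hq] with y h1 h2
    rw [Real.log_div (norm_ne_zero_iff.2 (sub_ne_zero.2 h1))
      (norm_ne_zero_iff.2 (sub_ne_zero.2 h2))]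

theorem integral_circle_pohozaev {a δ : ℝ} (hδ : 0 < δ) (ha : δ < a) :
    -(δ * ∫ θ in (-π)..π, ((δ + a * cos θ) / (δ ^ 2 + 2 * a * δ * cos θ + a ^ 2) - 1 / δ) *
        ((δ * cos θ + a) / (δ ^ 2 + 2 * a * δ * cos θ + a ^ 2) - cos θ / δ)) +
      1 / 2 * (δ * ∫ θ in (-π)..π, (1 / (δ ^ 2 + 2 * a * δ * cos θ + a ^ 2) + 1 / δ ^ 2 -
        2 * (δ + a * cos θ) / ((δ ^ 2 + 2 * a * δ * cos θ + a ^ 2) * δ)) * cos θ) =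
      2 * π / a := by
  have ha0 : 0 < a := hδ.trans ha
  have hP : ∀ θ, 0 < a + δ * cos θ := fun θ => by nlinarith [neg_one_le_cos θ]
  have hD : ∀ θ, 0 < δ ^ 2 + 2 * a * δ * cos θ + a ^ 2 := fun θ => by
    nlinarith [neg_one_le_cos θ, mul_pos ha0 hδ, mul_pos (sub_pos.2 ha) (sub_pos.2 ha)]
  have hD0 := fun θ => (hD θ).ne'
  have hDδ := fun θ => (mul_pos (hD θ) hδ).ne'
  have c1 : Continuous fun θ => ((δ + a * cos θ) / (δ ^ 2 + 2 * a * δ * cos θ + a ^ 2) - 1 / δ) *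
      ((δ * cos θ + a) / (δ ^ 2 + 2 * a * δ * cos θ + a ^ 2) - cos θ / δ) := by
    fun_prop (disch := assumption)
  have c2 : Continuous fun θ => (1 / (δ ^ 2 + 2 * a * δ * cos θ + a ^ 2) + 1 / δ ^ 2 -
      2 * (δ + a * cos θ) / ((δ ^ 2 + 2 * a * δ * cos θ + a ^ 2) * δ)) * cos θ := by
    fun_prop (disch := assumption)
  have hderiv : ∀ θ, HasDerivAt (fun θ => -(δ / 2) * (sin θ / (δ ^ 2 + 2 * a * δ * cos θ + a ^ 2))
      - sin θ / (2 * δ) + θ / a - arctan (δ * sin θ / (a + δ * cos θ)) / a)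
      (-δ * (((δ + a * cos θ) / (δ ^ 2 + 2 * a * δ * cos θ + a ^ 2) - 1 / δ) *
        ((δ * cos θ + a) / (δ ^ 2 + 2 * a * δ * cos θ + a ^ 2) - cos θ / δ)) +
      δ / 2 * ((1 / (δ ^ 2 + 2 * a * δ * cos θ + a ^ 2) + 1 / δ ^ 2 -
        2 * (δ + a * cos θ) / ((δ ^ 2 + 2 * a * δ * cos θ + a ^ 2) * δ)) * cos θ)) θ := by
    intro θ
    have hDd : HasDerivAt (fun θ => δ ^ 2 + 2 * a * δ * cos θ + a ^ 2)
        (2 * a * δ * -sin θ) θ :=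
      (((hasDerivAt_cos θ).const_mul (2 * a * δ)).const_add (δ ^ 2)).add_const (a ^ 2)
    have hPd : HasDerivAt (fun θ => a + δ * cos θ) (δ * -sin θ) θ :=
      ((hasDerivAt_cos θ).const_mul δ).const_add a
    have hA := (((hasDerivAt_sin θ).const_mul δ).div hPd (hP θ).ne').arctan
    have hF := (((((hasDerivAt_sin θ).div hDd (hD0 θ)).const_mul (-(δ / 2))).sub
      ((hasDerivAt_sin θ).div_const (2 * δ))).add ((hasDerivAt_id θ).div_const a)).sub
      (hA.div_const a)
    refine hF.congr_deriv ?_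
    have hs := sin_sq_add_cos_sq θ
    have hinv : 1 / (1 + (δ * sin θ / (a + δ * cos θ)) ^ 2) =
        (a + δ * cos θ) ^ 2 / (δ ^ 2 + 2 * a * δ * cos θ + a ^ 2) := by
      have : (a + δ * cos θ) ^ 2 + (δ * sin θ) ^ 2 = δ ^ 2 + 2 * a * δ * cos θ + a ^ 2 := by
        linear_combination δ ^ 2 * hs
      rw [← this]
      have := hP θ
      field_simp
    simp only [Pi.div_apply, hinv]
    have h1 := hP θ
    have h2 := hD θ
    have hss : sin θ ^ 2 = 1 - cos θ ^ 2 := by linear_combination hs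
    generalize hDe : δ ^ 2 + 2 * a * δ * cos θ + a ^ 2 = D at *
    generalize cos θ = c at *
    generalize sin θ = s at *
    field_simp
    subst hDe
    rw [hss]
    ring
  have hint := intervalIntegral.integral_eq_sub_of_hasDerivAt (a := -π) (b := π)
    (fun θ _ => hderiv θ)
    (((c1.const_mul (-δ)).add (c2.const_mul (δ / 2))).intervalIntegrable _ _)
  rw [intervalIntegral.integral_add ((c1.const_mul (-δ)).intervalIntegrable _ _)
    ((c2.const_mul (δ / 2)).intervalIntegrable _ _), intervalIntegral.integral_const_mul,
    intervalIntegral.integral_const_mul] at hint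
  simp only [sin_neg, cos_neg, sin_pi, cos_pi, neg_zero, mul_zero, zero_div, arctan_zero] at hint
  linear_combination hint

/-- **Pohozaev boundary integral of the half-plane Green function** (cf. Lemma C.3). For the
Green function `𝔾(x) = (1/2π) ln(|x−z̄|/|x−z|)` of `−Δ` on the half plane with pole at
`z = (z₁,0)`, and any `0 < δ < z₁`,
`−∫_{∂B_δ(z)} ∂_ν𝔾 ∂₁𝔾 + ½ ∫_{∂B_δ(z)} |∇𝔾|² ν₁ = 1/(4π z₁)`. -/
theorem green_function_pohozaev_boundary (z₁ : ℝ) (hz₁ : 0 < z₁)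
    (δ : ℝ) (hδ : 0 < δ) (hδ' : δ < z₁)
    (z : Plane) (hz : z = mk2 z₁ 0) (G : Plane → ℝ)
    (hG : G = fun x => (1 / (2 * π)) * Real.log (‖x - reflPt z‖ / ‖x - z‖)) :
    -(∫ x in Metric.sphere z δ,
        (⟪gradient G x, x - z⟫ / δ) * (gradient G x 0) ∂μH[1])
      + (1 / 2) * (∫ x in Metric.sphere z δ, ‖gradient G x‖ ^ 2 * ((x 0 - z 0) / δ) ∂μH[1])
    = 1 / (4 * π * z₁) := by
  subst hz
  set z := mk2 z₁ 0 with hz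
  have hz0 : z 0 = z₁ := rfl
  have hz1 : z 1 = 0 := rfl
  have hp0 : reflPt z 0 = -z₁ := rfl
  have hp1 : reflPt z 1 = 0 := rfl
  let g : Plane → Plane := fun x => (1 / (2 * π)) •
    ((‖x - reflPt z‖ ^ 2)⁻¹ • (x - reflPt z) - (‖x - z‖ ^ 2)⁻¹ • (x - z))
  have hgm : Measurable g := by fun_prop
  have hgrad : ∀ x ∈ Metric.sphere z δ, gradient G x = g x := by
    intro x hx
    rw [mem_sphere_iff_norm] at hx
    rw [hG]
    refine (hasGradientAt_log_norm_div ?_ ?_).gradient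
    · rintro rfl
      have h := norm_sq_plane (reflPt z - z)
      simp only [hx, PiLp.sub_apply, hp0, hp1, hz0, hz1] at h
      nlinarith
    · rintro rfl
      simp [hδ.ne] at hx
  have hms : MeasurableSet (Metric.sphere z δ) := Metric.isClosed_sphere.measurableSet
  have hxp : ∀ θ, ‖circlePt z δ θ - reflPt z‖ ^ 2 =
      δ ^ 2 + 2 * (2 * z₁) * δ * cos θ + (2 * z₁) ^ 2 := by
    intro θ
    rw [norm_sq_plane]
    simp only [PiLp.sub_apply, circlePt_zero, circlePt_one, hp0, hp1, hz0, hz1]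
    linear_combination δ ^ 2 * sin_sq_add_cos_sq θ
  have hxz : ∀ θ, ‖circlePt z δ θ - z‖ ^ 2 = δ ^ 2 := by
    intro θ
    rw [norm_sq_plane]
    simp only [PiLp.sub_apply, circlePt_zero, circlePt_one]
    linear_combination δ ^ 2 * sin_sq_add_cos_sq θ
  have hD : ∀ θ, 0 < δ ^ 2 + 2 * (2 * z₁) * δ * cos θ + (2 * z₁) ^ 2 := fun θ => by
    nlinarith [neg_one_le_cos θ, mul_pos hz₁ hδ, sq_nonneg (z₁ - δ), sq_nonneg z₁]
  have hgc0 : ∀ θ, g (circlePt z δ θ) 0 = 1 / (2 * π) * ((δ * cos θ + 2 * z₁) /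
      (δ ^ 2 + 2 * (2 * z₁) * δ * cos θ + (2 * z₁) ^ 2) - cos θ / δ) := by
    intro θ
    simp only [g, hxp, hxz, PiLp.smul_apply, PiLp.sub_apply, circlePt_zero, smul_eq_mul, hp0, hz0]
    have := hD θ
    field_simp
    ring
  have hgc1 : ∀ θ, g (circlePt z δ θ) 1 = 1 / (2 * π) * (δ * sin θ /
      (δ ^ 2 + 2 * (2 * z₁) * δ * cos θ + (2 * z₁) ^ 2) - sin θ / δ) := by
    intro θ
    simp only [g, hxp, hxz, PiLp.smul_apply, PiLp.sub_apply, circlePt_one, smul_eq_mul, hp1, hz1]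
    have := hD θ
    field_simp
    ring
  have e1 : ∫ x in Metric.sphere z δ,
      (⟪gradient G x, x - z⟫ / δ) * (gradient G x 0) ∂μH[1] =
      δ * ∫ θ in (-π)..π, (1 / (2 * π)) ^ 2 * (((δ + 2 * z₁ * cos θ) /
        (δ ^ 2 + 2 * (2 * z₁) * δ * cos θ + (2 * z₁) ^ 2) - 1 / δ) *
        ((δ * cos θ + 2 * z₁) / (δ ^ 2 + 2 * (2 * z₁) * δ * cos θ + (2 * z₁) ^ 2)
          - cos θ / δ)) := by
    rw [setIntegral_congr_fun (g := fun x => (⟪g x, x - z⟫ / δ) * g x 0) hms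
      (fun x hx => by simp only [hgrad x hx]),
      integral_sphere_eq_intervalIntegral z hδ (by fun_prop)]
    congr 1
    refine intervalIntegral.integral_congr fun θ _ => ?_
    have hin : ⟪g (circlePt z δ θ), circlePt z δ θ - z⟫ =
        g (circlePt z δ θ) 0 * (δ * cos θ) + g (circlePt z δ θ) 1 * (δ * sin θ) := by
      simp only [PiLp.inner_apply, Fin.sum_univ_two, PiLp.sub_apply, circlePt_zero, circlePt_one,
        add_sub_cancel_left, RCLike.inner_apply, conj_trivial]
      ring
    simp only [hin]
    rw [hgc0, hgc1]
    have h1 := hD θ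
    have hss : sin θ ^ 2 = 1 - cos θ ^ 2 := by linear_combination sin_sq_add_cos_sq θ
    generalize hDe : δ ^ 2 + 2 * (2 * z₁) * δ * cos θ + (2 * z₁) ^ 2 = D at *
    generalize cos θ = c at *
    generalize sin θ = s at *
    field_simp
    subst hDe
    rw [hss]
    ring
  have e2 : ∫ x in Metric.sphere z δ, ‖gradient G x‖ ^ 2 * ((x 0 - z 0) / δ) ∂μH[1] =
      δ * ∫ θ in (-π)..π, (1 / (2 * π)) ^ 2 *
        ((1 / (δ ^ 2 + 2 * (2 * z₁) * δ * cos θ + (2 * z₁) ^ 2) + 1 / δ ^ 2 -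
        2 * (δ + 2 * z₁ * cos θ) /
          ((δ ^ 2 + 2 * (2 * z₁) * δ * cos θ + (2 * z₁) ^ 2) * δ)) * cos θ) := by
    rw [setIntegral_congr_fun (g := fun x => ‖g x‖ ^ 2 * ((x 0 - z 0) / δ)) hms
      (fun x hx => by simp only [hgrad x hx]),
      integral_sphere_eq_intervalIntegral z hδ (by fun_prop)]
    congr 1
    refine intervalIntegral.integral_congr fun θ _ => ?_
    simp only [norm_sq_plane, circlePt_zero]
    rw [hgc0, hgc1]
    have h1 := hD θ
    have hss : sin θ ^ 2 = 1 - cos θ ^ 2 := by linear_combination sin_sq_add_cos_sq θ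
    generalize hDe : δ ^ 2 + 2 * (2 * z₁) * δ * cos θ + (2 * z₁) ^ 2 = D at *
    generalize cos θ = c at *
    generalize sin θ = s at *
    field_simp
    subst hDe
    rw [hss]
    ring
  rw [e1, e2, intervalIntegral.integral_const_mul, intervalIntegral.integral_const_mul]
  have h := integral_circle_pohozaev hδ (by linarith : δ < 2 * z₁)
  have hπ := pi_pos
  have h4 : 1 / (4 * π * z₁) = (1 / (2 * π)) ^ 2 * (2 * π / (2 * z₁)) := by
    field_simp
    ring
  rw [h4, ← h]
  ring
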